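/- Let A be a regular Hopf coquasigroup over a field k and let ψ and ψ' be two faithful right integrals on A. Then there exists a scalar λ ∈ k such that ψ' = λψ; i.e., the faithful right integral on A is unique up to a scalar. -/

import Mathlib

open TensorProduct

/-- A regular Hopf coquasigroup over a field `k`: a unital associative `k`-algebra `A`
with a (not necessarily coassociative) coproduct `comul : A →ₐ[k] A ⊗[k] A`, a counit
`counit : A →ₐ[k] k`, and a bijective antipode `antipode : A ≃ₗ[k] A` which is
antimultiplicative, anticomultiplicative, and satisfies the quasigroup antipode
identities. -/
structure RegularHopfCoquasigroup (k A : Type*) [Field k] [Ring A] [Algebra k A] where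
  comul : A →ₐ[k] A ⊗[k] A
  counit : A →ₐ[k] k
  antipode : A ≃ₗ[k] A
  /-- `(ε ⊗ id) ∘ Δ = id` -/
  counit_comul_left : ∀ a : A,
    (TensorProduct.lid k A) ((LinearMap.rTensor A counit.toLinearMap) (comul a)) = a
  /-- `(id ⊗ ε) ∘ Δ = id` -/
  counit_comul_right : ∀ a : A,
    (TensorProduct.rid k A) ((LinearMap.lTensor A counit.toLinearMap) (comul a)) = a
  /-- `S(ab) = S(b)S(a)` -/
  antipode_mul : ∀ a b : A, antipode (a * b) = antipode b * antipode a
  /-- `S(1) = 1` -/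
  antipode_one : antipode (1 : A) = 1
  /-- `Δ ∘ S = (S ⊗ S) ∘ flip ∘ Δ` -/
  antipode_comul : ∀ a : A,
    comul (antipode a) =
      (TensorProduct.map antipode.toLinearMap antipode.toLinearMap)
        ((TensorProduct.comm k A A) (comul a))
  /-- `S(a₍₁₎)a₍₂₎₍₁₎ ⊗ a₍₂₎₍₂₎ = 1 ⊗ a` -/
  quasi₁ : ∀ a : A,
    (LinearMap.rTensor A (LinearMap.mul' k A))
      ((TensorProduct.assoc k A A A).symm
        ((LinearMap.rTensor (A ⊗[k] A) antipode.toLinearMap)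
          ((LinearMap.lTensor A comul.toLinearMap) (comul a)))) = (1 : A) ⊗ₜ[k] a
  /-- `a₍₁₎S(a₍₂₎₍₁₎) ⊗ a₍₂₎₍₂₎ = 1 ⊗ a` -/
  quasi₂ : ∀ a : A,
    (LinearMap.rTensor A (LinearMap.mul' k A))
      ((TensorProduct.assoc k A A A).symm
        ((LinearMap.lTensor A (LinearMap.rTensor A antipode.toLinearMap))
          ((LinearMap.lTensor A comul.toLinearMap) (comul a)))) = (1 : A) ⊗ₜ[k] a
  /-- `a₍₁₎₍₁₎ ⊗ S(a₍₁₎₍₂₎)a₍₂₎ = a ⊗ 1` -/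
  quasi₃ : ∀ a : A,
    (LinearMap.lTensor A (LinearMap.mul' k A))
      ((TensorProduct.assoc k A A A)
        ((LinearMap.rTensor A (LinearMap.lTensor A antipode.toLinearMap))
          ((LinearMap.rTensor A comul.toLinearMap) (comul a)))) = a ⊗ₜ[k] (1 : A)
  /-- `a₍₁₎₍₁₎ ⊗ a₍₁₎₍₂₎S(a₍₂₎) = a ⊗ 1` -/
  quasi₄ : ∀ a : A,
    (LinearMap.lTensor A (LinearMap.mul' k A))
      ((TensorProduct.assoc k A A A)
        ((LinearMap.lTensor (A ⊗[k] A) antipode.toLinearMap)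
          ((LinearMap.rTensor A comul.toLinearMap) (comul a)))) = a ⊗ₜ[k] (1 : A)

variable {k A : Type*} [Field k] [Ring A] [Algebra k A]

/-- `(id ⊗ f)` on `A ⊗[k] A`, composed with `A ⊗ k ≅ A`; so `idT f (a ⊗ b) = f b • a`,
i.e. in Sweedler notation `idT f (Δ a) = a₍₁₎ f(a₍₂₎)`. -/
noncomputable def idT (f : A →ₗ[k] k) : A ⊗[k] A →ₗ[k] A :=
  (TensorProduct.rid k A).toLinearMap ∘ₗ LinearMap.lTensor A f

/-- `(f ⊗ id)` on `A ⊗[k] A`, composed with `k ⊗ A ≅ A`; so `Tid f (a ⊗ b) = f a • b`,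
i.e. in Sweedler notation `Tid f (Δ a) = f(a₍₁₎) a₍₂₎`. -/
noncomputable def Tid (f : A →ₗ[k] k) : A ⊗[k] A →ₗ[k] A :=
  (TensorProduct.lid k A).toLinearMap ∘ₗ LinearMap.rTensor A f

/-- A linear functional `f` on `A` is faithful if `f(a·) = 0` implies `a = 0` and
`f(·a) = 0` implies `a = 0`. -/
def Faithful (f : A →ₗ[k] k) : Prop :=
  (∀ a : A, (∀ b : A, f (a * b) = 0) → a = 0) ∧
  (∀ a : A, (∀ b : A, f (b * a) = 0) → a = 0)

/-- A left integral: a nonzero functional `φ` with `a₍₁₎ φ(a₍₂₎) = φ(a)·1`. -/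
def IsLeftIntegral (H : RegularHopfCoquasigroup k A) (φ : A →ₗ[k] k) : Prop :=
  φ ≠ 0 ∧ ∀ a : A, idT φ (H.comul a) = φ a • (1 : A)

/-- A right integral: a nonzero functional `ψ` with `ψ(a₍₁₎) a₍₂₎ = ψ(a)·1`. -/
def IsRightIntegral (H : RegularHopfCoquasigroup k A) (ψ : A →ₗ[k] k) : Prop :=
  ψ ≠ 0 ∧ ∀ a : A, Tid ψ (H.comul a) = ψ a • (1 : A)

section Slicing

variable (f g : A →ₗ[k] k)

@[simp] lemma idT_tmul (a b : A) : idT f (a ⊗ₜ[k] b) = f b • a := by simp [idT]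

@[simp] lemma Tid_tmul (a b : A) : Tid f (a ⊗ₜ[k] b) = f a • b := by simp [Tid]

lemma apply_idT_eq_apply_Tid (t : A ⊗[k] A) : f (idT g t) = g (Tid f t) := by
  induction t with
  | zero => simp
  | tmul a b => simp [mul_comm]
  | add s t hs ht => simp [hs, ht]

lemma Tid_mul_one_tmul (t : A ⊗[k] A) (b : A) :
    Tid f (t * (1 ⊗ₜ[k] b)) = Tid f t * b := by
  induction t with
  | zero => simp
  | tmul p q => simp
  | add s t hs ht => simp [add_mul, hs, ht]

lemma Tid_one_tmul_mul (t : A ⊗[k] A) (b : A) :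
    Tid f ((1 ⊗ₜ[k] b) * t) = b * Tid f t := by
  induction t with
  | zero => simp
  | tmul p q => simp
  | add s t hs ht => simp [mul_add, hs, ht]

lemma idT_mul_tmul_one (t : A ⊗[k] A) (b : A) :
    idT f (t * (b ⊗ₜ[k] 1)) = idT f t * b := by
  induction t with
  | zero => simp
  | tmul p q => simp
  | add s t hs ht => simp [add_mul, hs, ht]

lemma idT_tmul_one_mul (t : A ⊗[k] A) (b : A) :
    idT f ((b ⊗ₜ[k] 1) * t) = b * idT f t := by
  induction t with
  | zero => simp
  | tmul p q => simp
  | add s t hs ht => simp [mul_add, hs, ht]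

lemma Tid_mul_tmul_one (t : A ⊗[k] A) (b : A) :
    Tid f (t * (b ⊗ₜ[k] 1)) = Tid (f ∘ₗ LinearMap.mulRight k b) t := by
  induction t with
  | zero => simp
  | tmul p q => simp
  | add s t hs ht => simp [add_mul, hs, ht]

lemma apply_idT_lTensor (S : A →ₗ[k] A) (t : A ⊗[k] A) :
    f (idT g (LinearMap.lTensor A S t)) = g (S (Tid f t)) := by
  induction t with
  | zero => simp
  | tmul a b => simp [mul_comm]
  | add s t hs ht => simp [hs, ht]

end Slicing

section Integrals

variable {H : RegularHopfCoquasigroup k A} {φ ψ ψ' : A →ₗ[k] k}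

lemma lTensor_mul'_assoc_tmul (t : A ⊗[k] A) (b : A) :
    LinearMap.lTensor A (LinearMap.mul' k A) (TensorProduct.assoc k A A A (t ⊗ₜ[k] b)) =
      t * (1 ⊗ₜ[k] b) := by
  induction t with
  | zero => simp
  | tmul p q => simp
  | add s t hs ht => simp [add_mul, TensorProduct.add_tmul, hs, ht]

lemma rTensor_symm_rTensor_mul'_assoc_tmul (H : RegularHopfCoquasigroup k A) (a : A)
    (t : A ⊗[k] A) :
    LinearMap.rTensor A H.antipode.symm.toLinearMap
      (LinearMap.rTensor A (LinearMap.mul' k A) ((TensorProduct.assoc k A A A).symm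
        (a ⊗ₜ[k] LinearMap.rTensor A H.antipode.toLinearMap t))) =
      t * (H.antipode.symm a ⊗ₜ[k] 1) := by
  induction t with
  | zero => simp
  | tmul p q =>
    have h : H.antipode.symm (a * H.antipode p) = p * H.antipode.symm a := by
      rw [LinearEquiv.symm_apply_eq, H.antipode_mul, LinearEquiv.apply_symm_apply]
    simp [h]
  | add s t hs ht =>
    simp only [map_add, TensorProduct.tmul_add, add_mul, hs, ht]

/-- Strong right invariance: `ψ(a₍₁₎b)a₍₂₎ = ψ(ab₍₁₎)S(b₍₂₎)`. -/
lemma IsRightIntegral.Tid_comul_mul (hψ : IsRightIntegral H ψ) (a b : A) :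
    Tid ψ (H.comul a * (b ⊗ₜ[k] 1)) =
      Tid ψ ((a ⊗ₜ[k] 1) * LinearMap.lTensor A H.antipode.toLinearMap (H.comul b)) := by
  rw [← H.quasi₄ b]
  generalize H.comul b = t
  induction t with
  | zero => simp
  | tmul p q =>
    simp only [LinearMap.rTensor_tmul, LinearMap.lTensor_tmul, AlgHom.toLinearMap_apply,
      lTensor_mul'_assoc_tmul]
    rw [← mul_assoc, ← map_mul, Tid_mul_one_tmul, hψ.2]
    simp
  | add s t hs ht => simp only [map_add, mul_add, hs, ht]

/-- Strong left invariance: `a₍₁₎φ(a₍₂₎b) = S⁻¹(b₍₁₎)φ(ab₍₂₎)`. -/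
lemma IsLeftIntegral.idT_comul_mul (hφ : IsLeftIntegral H φ) (a b : A) :
    idT φ (H.comul a * (1 ⊗ₜ[k] b)) =
      idT φ ((1 ⊗ₜ[k] a) *
        LinearMap.rTensor A H.antipode.symm.toLinearMap (H.comul b)) := by
  have h1 : H.antipode.symm 1 = 1 := by
    rw [LinearEquiv.symm_apply_eq, H.antipode_one]
  have h : (1 : A) ⊗ₜ[k] b = LinearMap.rTensor A H.antipode.symm.toLinearMap (1 ⊗ₜ[k] b) := by
    simp [h1]
  rw [h, ← H.quasi₂ b]
  generalize H.comul b = t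
  induction t with
  | zero => simp
  | tmul p q =>
    simp only [LinearMap.lTensor_tmul, AlgHom.toLinearMap_apply,
      rTensor_symm_rTensor_mul'_assoc_tmul]
    rw [← mul_assoc, ← map_mul, idT_mul_tmul_one, hφ.2]
    simp
  | add s t hs ht => simp only [map_add, mul_add, hs, ht]

lemma IsRightIntegral.comp_antipode (hψ : IsRightIntegral H ψ) :
    IsLeftIntegral H (ψ ∘ₗ H.antipode.toLinearMap) := by
  refine ⟨fun h => hψ.1 ?_, fun a => H.antipode.injective ?_⟩
  · ext a
    simpa using LinearMap.congr_fun h (H.antipode.symm a)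
  · have key : ∀ t : A ⊗[k] A, H.antipode (idT (ψ ∘ₗ H.antipode.toLinearMap) t) =
        Tid ψ (TensorProduct.map H.antipode.toLinearMap H.antipode.toLinearMap
          (TensorProduct.comm k A A t)) := by
      intro t
      induction t with
      | zero => simp
      | tmul p q => simp
      | add s t hs ht => simp only [map_add, hs, ht]
    rw [key, ← H.antipode_comul, hψ.2]
    simp [H.antipode_one]

lemma exists_eq_left_mul (hφ : IsLeftIntegral H φ) (hψ : IsRightIntegral H ψ) :
    ∃ d : A, ∀ x, ψ x = φ (x * d) := by
  obtain ⟨c, hc⟩ : ∃ c, φ c ≠ 0 := by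
    by_contra! h
    exact hφ.1 (LinearMap.ext h)
  refine ⟨(φ c)⁻¹ •
    Tid ψ (LinearMap.rTensor A H.antipode.symm.toLinearMap (H.comul c)), fun x => ?_⟩
  have h := congrArg ψ (hφ.idT_comul_mul x c)
  rw [apply_idT_eq_apply_Tid, apply_idT_eq_apply_Tid, Tid_mul_one_tmul, hψ.2,
    Tid_one_tmul_mul] at h
  simp only [smul_mul_assoc, one_mul, map_smul, smul_eq_mul] at h
  rw [mul_smul_comm, map_smul, ← h, smul_eq_mul]
  field_simp

lemma IsRightIntegral.exists_apply_idT_comul_mul (hψ : IsRightIntegral H ψ) (f : A →ₗ[k] k)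
    (w : A ⊗[k] A) : ∃ e : A, ∀ x, ψ (idT f (H.comul x * w)) = ψ (x * e) := by
  induction w with
  | zero => exact ⟨0, by simp⟩
  | tmul p q =>
    refine ⟨idT f (LinearMap.lTensor A H.antipode.toLinearMap (H.comul p) * (1 ⊗ₜ[k] q)),
      fun x => ?_⟩
    have h : p ⊗ₜ[k] q = (p ⊗ₜ[k] (1 : A)) * (1 ⊗ₜ[k] q) := by simp
    rw [h, ← mul_assoc, apply_idT_eq_apply_Tid, Tid_mul_one_tmul, hψ.Tid_comul_mul,
      ← Tid_mul_one_tmul, ← apply_idT_eq_apply_Tid, mul_assoc, idT_tmul_one_mul]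
  | add s t hs ht =>
    obtain ⟨d, hd⟩ := hs
    obtain ⟨e, he⟩ := ht
    exact ⟨d + e, fun x => by simp only [mul_add, map_add, hd, he]⟩

lemma exists_left_mul_eq_right_mul (hφ : IsLeftIntegral H φ) (hψ : IsRightIntegral H ψ)
    (d : A) : ∃ e : A, ∀ x, φ (x * d) = ψ (x * e) := by
  obtain ⟨a, ha⟩ : ∃ a, ψ a ≠ 0 := by
    by_contra! h
    exact hψ.1 (LinearMap.ext h)
  obtain ⟨e, he⟩ := hψ.exists_apply_idT_comul_mul φ (H.comul d * (a ⊗ₜ[k] 1))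
  refine ⟨(ψ a)⁻¹ • e, fun x => ?_⟩
  have h := he x
  rw [← mul_assoc, ← map_mul, idT_mul_tmul_one, hφ.2] at h
  simp only [smul_mul_assoc, one_mul, map_smul, smul_eq_mul] at h
  rw [mul_smul_comm, map_smul, ← h, smul_eq_mul]
  field_simp

lemma eq_counit_smul_one_of_isRightIntegral (hψ : IsRightIntegral H ψ)
    (hfψ : Faithful ψ) (hψ' : IsRightIntegral H ψ') {e : A} (he : ∀ x, ψ' x = ψ (x * e)) :
    e = H.counit e • (1 : A) := by
  have hcomp : ψ ∘ₗ LinearMap.mulRight k e = ψ' := by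
    ext x
    simp [he]
  have hg (g : A →ₗ[k] k) :
      idT g (LinearMap.lTensor A H.antipode.toLinearMap (H.comul e)) = g 1 • e := by
    rw [← sub_eq_zero]
    refine hfψ.2 _ fun x => ?_
    have h := congrArg g (hψ.Tid_comul_mul x e)
    rw [Tid_mul_tmul_one, hcomp, hψ'.2, ← apply_idT_eq_apply_Tid, idT_tmul_one_mul] at h
    rw [mul_sub, map_sub, ← h]
    simp [he, mul_comm]
  have hS : H.antipode e - H.counit e • (1 : A) = 0 := by
    rw [← Module.forall_dual_apply_eq_zero_iff k]
    intro g
    have h := congrArg H.counit.toLinearMap (hg g)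
    have hc : Tid H.counit.toLinearMap (H.comul e) = e := H.counit_comul_left e
    rw [apply_idT_lTensor, hc] at h
    simp only [LinearEquiv.coe_coe, map_smul, AlgHom.toLinearMap_apply, smul_eq_mul] at h
    rw [map_sub, h, map_smul, smul_eq_mul, mul_comm, sub_self]
  apply H.antipode.injective
  rw [map_smul, H.antipode_one]
  exact sub_eq_zero.mp hS

end Integrals

/-- faithful right integrals are unique up to a scalar. -/
theorem stmt_8 (k A : Type*) [Field k] [Ring A] [Algebra k A]
    (H : RegularHopfCoquasigroup k A) (ψ ψ' : A →ₗ[k] k)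
    (hψ : IsRightIntegral H ψ) (hfψ : Faithful ψ)
    (hψ' : IsRightIntegral H ψ') (hfψ' : Faithful ψ') :
    ∃ lam : k, ψ' = lam • ψ := by
  obtain ⟨d, hd⟩ := exists_eq_left_mul hψ.comp_antipode hψ'
  obtain ⟨e, he⟩ := exists_left_mul_eq_right_mul hψ.comp_antipode hψ d
  have h : ∀ x, ψ' x = ψ (x * e) := fun x => (hd x).trans (he x)
  refine ⟨H.counit e, LinearMap.ext fun x => ?_⟩
  rw [h, eq_counit_smul_one_of_isRightIntegral hψ hfψ hψ' h]
  simp
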